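/- For x, y in a commutative ring (e.g. x, y ∈ ℝ) define Q_{n,i}(x,y) = Σ_{π ∈ D_{n,i}} x^{exc(π)} y^{cdes(π)} and Q_n(x,y) = Σ_{i=1}^{n} Q_{n,i}(x,y), where D_{n,i} is the set of derangements π of [n] with π(i) = 1. Then for every n ≥ 2 and every i with 2 ≤ i ≤ n+1: Q_{n+1,i}(x,y) = x·Q_{n−1}(x,y) + x·Σ_{j=2}^{i−1} Q_{n,j}(x,y) + y·Σ_{j=i}^{n} Q_{n,j}(x,y). -/

import Mathlib

open Equiv Finset

/-- Number of excedances of a permutation of `Fin n` (`π i > i`). -/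
def exc {n : ℕ} (π : Equiv.Perm (Fin n)) : ℕ :=
  (Finset.univ.filter fun i => i < π i).card

/-- Number of fixed points. -/
def fixpts {n : ℕ} (π : Equiv.Perm (Fin n)) : ℕ :=
  (Finset.univ.filter fun i => π i = i).card

/-- The set of cycle descents of `π`: those `c` with `π c < c` such that `π c`
is not the smallest element of the cycle containing `c`. -/
def cdesSet {n : ℕ} (π : Equiv.Perm (Fin n)) : Finset (Fin n) :=
  Finset.univ.filter fun c => π c < c ∧ ∃ j, π.SameCycle c j ∧ j < π c

/-- The number of cycle descents of `π`. -/
def cdes {n : ℕ} (π : Equiv.Perm (Fin n)) : ℕ := (cdesSet π).card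

/-- The number of cycles of `π`, counted via cycle minima. -/
def cyc {n : ℕ} (π : Equiv.Perm (Fin n)) : ℕ :=
  (Finset.univ.filter fun c : Fin n => ∀ j, π.SameCycle c j → c ≤ j).card
/-- D_{n,i}: derangements π of [n] with π(i) = 1, encoded on Fin n
(position i of [n] is the j : Fin n with j.val + 1 = i; element 1 is 0 : Fin n). -/
def Dni (n i : ℕ) : Finset (Equiv.Perm (Fin n)) :=
  Finset.univ.filter fun π =>
    (∀ j, π j ≠ j) ∧ ∃ j : Fin n, (j : ℕ) + 1 = i ∧ ((π j : Fin n) : ℕ) = 0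

/-- Q_{n,i}(x,y) = Σ_{π ∈ D_{n,i}} x^{exc(π)} y^{cdes(π)}. -/
noncomputable def Qni (n i : ℕ) (x y : ℝ) : ℝ :=
  ∑ π ∈ Dni n i, x ^ exc π * y ^ cdes π

/-- Q_n(x,y) = Σ_{i=1}^n Q_{n,i}(x,y). -/
noncomputable def Qn (n : ℕ) (x y : ℝ) : ℝ :=
  ∑ i ∈ Finset.Icc 1 n, Qni n i x y

/-- Extend a permutation of `Fin n` to `Fin (n+1)` with `i` fixed. -/
def liftP {n : ℕ} (i : Fin (n+1)) (σ : Equiv.Perm (Fin n)) : Equiv.Perm (Fin (n+1)) :=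
  (finSuccEquiv' i).symm.permCongr (Equiv.optionCongr σ)

theorem liftP_self {n : ℕ} (i : Fin (n+1)) (σ : Equiv.Perm (Fin n)) : liftP i σ i = i := by
  simp [liftP, Equiv.permCongr_apply]

theorem liftP_succAbove {n : ℕ} (i : Fin (n+1)) (σ : Equiv.Perm (Fin n)) (j : Fin n) :
    liftP i σ (i.succAbove j) = i.succAbove (σ j) := by
  simp [liftP, Equiv.permCongr_apply]

theorem liftP_injective {n : ℕ} (i : Fin (n+1)) : Function.Injective (liftP i) := by
  intro σ τ h
  ext j
  have := congrArg (fun π => π (i.succAbove j)) h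
  simp only [liftP_succAbove] at this
  rw [Fin.succAbove_right_injective this]

theorem liftP_surj {n : ℕ} (i : Fin (n+1)) (τ : Equiv.Perm (Fin (n+1))) (h : τ i = i) :
    ∃ σ, liftP i σ = τ := by
  let τ' : Equiv.Perm (Option (Fin n)) := (finSuccEquiv' i).permCongr τ
  have h0 : τ' none = none := by simp [τ', Equiv.permCongr_apply, h]
  have h1 := Equiv.Perm.decomposeOption.symm_apply_apply τ'
  have h2 : τ' = Equiv.optionCongr (Equiv.removeNone τ') := by
    rw [Equiv.Perm.decomposeOption_symm_apply, Equiv.Perm.decomposeOption_apply] at h1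
    simp only [h0, Equiv.swap_self] at h1
    exact h1.symm
  refine ⟨Equiv.removeNone τ', ?_⟩
  unfold liftP
  rw [← h2]
  ext c
  simp [τ', Equiv.permCongr_apply]

theorem sameCycle_map {α β : Type*} [Finite α] (π : Equiv.Perm α) (σ : Equiv.Perm β) (f : α → β)
    (h : ∀ a, σ.SameCycle (f a) (f (π a))) {a b : α} (hab : π.SameCycle a b) :
    σ.SameCycle (f a) (f b) := by
  obtain ⟨m, -, rfl⟩ := hab.exists_pow_eq'
  induction m with
  | zero => exact Equiv.Perm.SameCycle.refl _ _
  | succ k ih =>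
    rw [pow_succ']
    exact (ih ⟨k, by simp⟩).trans (h _)

theorem sameCycle_apply_self {α : Type*} (π : Equiv.Perm α) (a : α) : π.SameCycle a (π a) :=
  ⟨1, by simp⟩

theorem exc_eq {n : ℕ} (π : Equiv.Perm (Fin n)) : exc π = ∑ i, if i < π i then 1 else 0 := by
  simp [exc]

theorem cdes_eq {n : ℕ} (π : Equiv.Perm (Fin n)) [∀ c, Decidable (π c < c ∧ ∃ j, π.SameCycle c j ∧ j < π c)] :
    cdes π = ∑ c, if (π c < c ∧ ∃ j, π.SameCycle c j ∧ j < π c) then 1 else 0 := by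
  rw [cdes, cdesSet, Finset.card_filter]
  refine Finset.sum_congr rfl fun c _ => ?_
  congr

section zero

theorem exc_lift_zero {n : ℕ} (σ : Equiv.Perm (Fin n)) : exc (liftP 0 σ) = exc σ := by
  have h := liftP_succAbove 0 σ
  simp only [Fin.succAbove_zero] at h
  simp only [exc_eq]
  rw [Fin.sum_univ_succ]
  simp [liftP_self, h]

theorem sameCycle_lift_zero {n : ℕ} (σ : Equiv.Perm (Fin n)) (a b : Fin n) :
    (liftP 0 σ).SameCycle a.succ b.succ ↔ σ.SameCycle a b := by
  have h := liftP_succAbove 0 σ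
  simp only [Fin.succAbove_zero] at h
  constructor
  · intro hab
    refine sameCycle_map (liftP 0 σ) σ (fun c => if hc : c = 0 then a else c.pred hc) ?_ hab
    intro c
    refine Fin.cases ?_ (fun j => ?_) c
    · simp [liftP_self, Equiv.Perm.SameCycle.refl]
    · simp [h, Equiv.Perm.SameCycle.refl]
  · refine sameCycle_map σ (liftP 0 σ) Fin.succ ?_
    intro c
    rw [← h]
    exact sameCycle_apply_self _ _

theorem cdes_lift_zero {n : ℕ} (σ : Equiv.Perm (Fin n)) : cdes (liftP 0 σ) = cdes σ := by
  classical
  have h := liftP_succAbove 0 σ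
  simp only [Fin.succAbove_zero] at h
  simp only [cdes_eq]
  rw [Fin.sum_univ_succ]
  simp only [liftP_self, lt_irrefl, false_and, if_false, zero_add, h]
  refine Finset.sum_congr rfl fun c _ => ?_
  refine if_congr ?_ rfl rfl
  rw [Fin.succ_lt_succ_iff]
  refine and_congr_right fun _ => ?_
  constructor
  · rintro ⟨j, hj, hlt⟩
    induction j using Fin.cases with
    | zero =>
      exfalso
      obtain ⟨m, -, hm⟩ := hj.symm.exists_pow_eq'
      have : ((liftP 0 σ)^m) 0 = 0 := by
        clear hm
        induction m with
        | zero => simp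
        | succ k ih => rw [pow_succ', Equiv.Perm.mul_apply, ih, liftP_self]
      rw [this] at hm
      exact (Fin.succ_ne_zero _) hm.symm
    | succ j => exact ⟨j, (sameCycle_lift_zero σ _ _).1 hj, by simpa using hlt⟩
  · rintro ⟨j, hj, hlt⟩
    exact ⟨j.succ, (sameCycle_lift_zero σ _ _).2 hj, by simpa using hlt⟩

end zero

/-- Insert `i` just before `0` in its cycle. -/
def insP {n : ℕ} (i : Fin (n+2)) (σ : Equiv.Perm (Fin (n+1))) : Equiv.Perm (Fin (n+2)) :=
  Equiv.swap 0 i * liftP i σ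

section ins

theorem insP_self {n : ℕ} (i : Fin (n+2)) (σ : Equiv.Perm (Fin (n+1))) : insP i σ i = 0 := by simp [insP, liftP_self]

theorem insP_succAbove {n : ℕ} (i : Fin (n+2)) (hi : i ≠ 0) (σ : Equiv.Perm (Fin (n+1))) (j : Fin (n+1)) :
    insP i σ (i.succAbove j) = if σ j = 0 then i else i.succAbove (σ j) := by
  simp only [insP, Equiv.Perm.mul_apply, liftP_succAbove]
  split_ifs with h
  · rw [h, Fin.succAbove_ne_zero_zero hi]; simp
  · apply Equiv.swap_apply_of_ne_of_ne
    · exact Fin.succAbove_ne_zero hi h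
    · exact Fin.succAbove_ne i _

theorem sameCycle_ins {n : ℕ} (i : Fin (n+2)) (hi : i ≠ 0) (σ : Equiv.Perm (Fin (n+1))) (a b : Fin (n+1)) :
    (insP i σ).SameCycle (i.succAbove a) (i.succAbove b) ↔ σ.SameCycle a b := by
  have h := insP_succAbove i hi σ
  constructor
  · intro hab
    have key := sameCycle_map (insP i σ) σ (fun c => i.insertNth (α := fun _ => Fin (n+1)) 0 id c) ?_ hab
    · simpa using key
    intro c
    induction c using Fin.succAboveCases i with
    | x =>
      simp only [insP_self]
      have e : (0 : Fin (n+2)) = i.succAbove 0 := (Fin.succAbove_ne_zero_zero hi).symm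
      rw [e]
      simp only [id, Fin.insertNth_apply_same, Fin.insertNth_apply_succAbove]
      exact Equiv.Perm.SameCycle.refl _ _
    | p j =>
      rw [h]
      split_ifs with h0
      · simp only [Fin.insertNth_apply_same, Fin.insertNth_apply_succAbove]
        rw [← h0]
        exact sameCycle_apply_self _ _
      · simp only [Fin.insertNth_apply_succAbove]
        exact sameCycle_apply_self _ _
  · refine sameCycle_map σ (insP i σ) i.succAbove ?_
    intro c
    by_cases h0 : σ c = 0
    · refine ⟨2, ?_⟩
      have : (insP i σ) ((insP i σ) (i.succAbove c)) = i.succAbove (σ c) := by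
        rw [h, if_pos h0, h0, insP_self, Fin.succAbove_ne_zero_zero hi]
      exact this
    · have := h c
      rw [if_neg h0] at this
      rw [← this]
      exact sameCycle_apply_self _ _

theorem exc_ins {n : ℕ} (i : Fin (n+2)) (hi : i ≠ 0) (σ : Equiv.Perm (Fin (n+1))) (k : Fin (n+1)) (hk : σ k = 0) :
    exc (insP i σ) = exc σ + if k.castSucc < i then 1 else 0 := by
  have h := insP_succAbove i hi σ
  simp only [exc_eq]
  rw [Fin.sum_univ_succAbove _ i]
  simp only [insP_self, Fin.not_lt_zero, if_false, zero_add, h]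
  rw [← Finset.add_sum_erase _ _ (Finset.mem_univ k), ← Finset.add_sum_erase _ _ (Finset.mem_univ k)]
  simp only [hk, Fin.not_lt_zero, if_false, zero_add, if_true, Fin.succAbove_lt_iff_castSucc_lt]
  rw [add_comm]
  congr 1
  refine Finset.sum_congr rfl fun c hc => ?_
  have hc0 : σ c ≠ 0 := fun h0 => (Finset.mem_erase.1 hc).1 (σ.injective (h0.trans hk.symm))
  simp [hc0]

theorem cdes_ins {n : ℕ} (i : Fin (n+2)) (hi : i ≠ 0) (σ : Equiv.Perm (Fin (n+1))) (k : Fin (n+1)) (hk : σ k = 0) :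
    cdes (insP i σ) = cdes σ + if k.castSucc < i then 0 else 1 := by
  classical
  have h := insP_succAbove i hi σ
  simp only [cdes_eq]
  rw [Fin.sum_univ_succAbove _ i]
  simp only [insP_self, Fin.not_lt_zero, and_false, exists_false, if_false, zero_add, h]
  rw [← Finset.add_sum_erase _ _ (Finset.mem_univ k), ← Finset.add_sum_erase _ _ (Finset.mem_univ k)]
  simp only [hk, Fin.not_lt_zero, and_false, exists_false, if_false, zero_add, if_true]
  rw [add_comm]
  congr 1
  · refine Finset.sum_congr rfl fun c hc => ?_
    have hc0 : σ c ≠ 0 := fun h0 => (Finset.mem_erase.1 hc).1 (σ.injective (h0.trans hk.symm))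
    simp only [hc0, if_false]
    refine if_congr ?_ rfl rfl
    rw [Fin.succAbove_lt_succAbove_iff]
    refine and_congr_right fun _ => ?_
    constructor
    · rintro ⟨j, hj, hlt⟩
      induction j using Fin.succAboveCases i with
      | x =>
        refine ⟨0, ?_, Fin.pos_iff_ne_zero.2 hc0⟩
        rw [← sameCycle_ins i hi, Fin.succAbove_ne_zero_zero hi]
        refine hj.trans ?_
        have := sameCycle_apply_self (insP i σ) i
        rwa [insP_self] at this
      | p j => exact ⟨j, (sameCycle_ins i hi σ _ _).1 hj, by simpa using hlt⟩
    · rintro ⟨j, hj, hlt⟩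
      exact ⟨_, (sameCycle_ins i hi σ _ _).2 hj, by simpa using hlt⟩
  · rw [← ite_not (p := k.castSucc < i)]
    refine if_congr ?_ rfl rfl
    rw [Fin.lt_succAbove_iff_le_castSucc, not_lt]
    refine and_iff_left ⟨0, ⟨2, ?_⟩, Fin.pos_iff_ne_zero.2 hi⟩
    have : (insP i σ) ((insP i σ) (i.succAbove k)) = 0 := by
      rw [h, if_pos hk, insP_self]
    exact this

theorem insP_injective {n : ℕ} (i : Fin (n+2)) : Function.Injective (insP i) := fun _ _ h =>
  liftP_injective i (mul_left_cancel h)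

theorem insP_derangement {n : ℕ} (i : Fin (n+2)) (hi : i ≠ 0) (σ : Equiv.Perm (Fin (n+1))) :
    (∀ c, insP i σ c ≠ c) ↔ ∀ j, j ≠ 0 → σ j ≠ j := by
  have h := insP_succAbove i hi σ
  rw [Fin.forall_iff_succAbove i]
  rw [insP_self]
  simp only [h]
  constructor
  · rintro ⟨-, h1⟩ j hj hjj
    have := h1 j
    rw [hjj, if_neg hj] at this
    exact this rfl
  · intro h1
    refine ⟨hi.symm, fun j => ?_⟩
    split_ifs with h0
    · exact (Fin.succAbove_ne i j).symm
    · intro h2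
      have h3 := Fin.succAbove_right_injective h2
      exact h1 j (fun hj => h0 (by rw [h3, hj])) h3

end ins

/-- The weight. -/
noncomputable def wt (x y : ℝ) {n : ℕ} (σ : Equiv.Perm (Fin n)) : ℝ := x ^ exc σ * y ^ cdes σ

theorem Qni_eq (x y : ℝ) (n : ℕ) (k : Fin (n+1)) :
    Qni (n+1) (k+1) x y =
      ∑ σ : Equiv.Perm (Fin (n+1)), if (∀ j, σ j ≠ j) ∧ σ k = 0 then wt x y σ else 0 := by
  rw [Qni, Dni, Finset.sum_filter]
  refine Finset.sum_congr rfl fun σ _ => ?_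
  refine if_congr (and_congr_right fun _ => ?_) rfl rfl
  constructor
  · rintro ⟨j, h1, h2⟩
    have : j = k := by ext; omega
    subst this
    exact Fin.ext h2
  · intro h
    exact ⟨k, rfl, by rw [h]; rfl⟩

theorem sum_Icc_one (n : ℕ) (f : ℕ → ℝ) :
    ∑ j ∈ Finset.Icc 1 n, f j = ∑ k : Fin n, f (k + 1) := by
  rw [Fin.sum_univ_eq_sum_range (fun k => f (k+1)), Finset.range_eq_Ico, Finset.sum_Ico_add' f 0 n 1]
  rfl

theorem Qn_eq (x y : ℝ) (n : ℕ) :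
    Qn (n+1) x y = ∑ σ : Equiv.Perm (Fin (n+1)), if (∀ j, σ j ≠ j) then wt x y σ else 0 := by
  rw [Qn, sum_Icc_one]
  simp only [Qni_eq]
  rw [Finset.sum_comm]
  refine Finset.sum_congr rfl fun σ _ => ?_
  rw [Finset.sum_eq_single (σ.symm 0)]
  · simp
  · intro b _ hb
    rw [if_neg]
    rintro ⟨-, h⟩
    exact hb (by rw [← h]; simp)
  · simp

/-- Sum over almost derangements with `σ k = 0`. -/
noncomputable def A (x y : ℝ) (n : ℕ) (k : Fin (n+1)) : ℝ :=
  ∑ σ : Equiv.Perm (Fin (n+1)), if (∀ j, j ≠ 0 → σ j ≠ j) ∧ σ k = 0 then wt x y σ else 0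

theorem A_succ (x y : ℝ) (n : ℕ) (k : Fin n) : A x y n k.succ = Qni (n+1) (k+2) x y := by
  have := Qni_eq x y n k.succ
  simp only [Fin.val_succ] at this
  rw [show (k:ℕ)+2 = k+1+1 from rfl, this, A]
  refine Finset.sum_congr rfl fun σ _ => ?_
  refine if_congr (and_congr_left fun h => ?_) rfl rfl
  constructor
  · intro h1 j hj
    by_cases h0 : j = 0
    · subst h0
      exact Fin.succ_ne_zero k (σ.injective (h.trans hj.symm))
    · exact h1 j h0 hj
  · exact fun h1 j _ => h1 j

theorem A_zero (x y : ℝ) (n : ℕ) : A x y (n+1) 0 = Qn (n+1) x y := by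
  rw [A, Qn_eq, ← Finset.sum_filter, ← Finset.sum_filter]
  symm
  refine Finset.sum_bij (fun σ _ => liftP 0 σ) ?_ ?_ ?_ ?_
  · intro σ hσ
    simp only [Finset.mem_filter, Finset.mem_univ, true_and] at hσ ⊢
    refine ⟨?_, liftP_self 0 σ⟩
    intro j hj
    obtain ⟨j, rfl⟩ := Fin.exists_succ_eq.2 hj
    have h := liftP_succAbove 0 σ j
    simp only [Fin.succAbove_zero] at h
    rw [h]
    simpa using hσ j
  · intro σ _ τ _ h
    exact liftP_injective 0 h
  · intro τ hτ
    simp only [Finset.mem_filter, Finset.mem_univ, true_and] at hτ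
    obtain ⟨σ, rfl⟩ := liftP_surj 0 τ hτ.2
    refine ⟨σ, ?_, rfl⟩
    simp only [Finset.mem_filter, Finset.mem_univ, true_and]
    intro j hj
    have h := liftP_succAbove 0 σ j
    simp only [Fin.succAbove_zero] at h
    exact hτ.1 j.succ (Fin.succ_ne_zero _) (by rw [h, hj])
  · intro σ _
    simp [wt, exc_lift_zero, cdes_lift_zero]

theorem wt_ins (x y : ℝ) {n : ℕ} (i : Fin (n+2)) (hi : i ≠ 0) (σ : Equiv.Perm (Fin (n+1)))
    (k : Fin (n+1)) (hk : σ k = 0) :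
    wt x y (insP i σ) = (if k.castSucc < i then x else y) * wt x y σ := by
  rw [wt, exc_ins i hi σ k hk, cdes_ins i hi σ k hk, wt]
  split_ifs <;> ring

theorem Qni_eq_A (x y : ℝ) (n : ℕ) (i : Fin (n+2)) (hi : i ≠ 0) :
    Qni (n+2) (i+1) x y = ∑ k : Fin (n+1), (if k.castSucc < i then x else y) * A x y n k := by
  have h1 : Qni (n+2) (i+1) x y = ∑ σ : Equiv.Perm (Fin (n+1)),
      if (∀ j, j ≠ 0 → σ j ≠ j) then wt x y (insP i σ) else 0 := by
    rw [Qni_eq, ← Finset.sum_filter, ← Finset.sum_filter]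
    symm
    refine Finset.sum_bij (fun σ _ => insP i σ) ?_ ?_ ?_ ?_
    · intro σ hσ
      simp only [Finset.mem_filter, Finset.mem_univ, true_and] at hσ ⊢
      exact ⟨(insP_derangement i hi σ).2 hσ, insP_self i σ⟩
    · intro σ _ τ _ h
      exact insP_injective i h
    · intro τ hτ
      simp only [Finset.mem_filter, Finset.mem_univ, true_and] at hτ
      obtain ⟨σ, hσ⟩ := liftP_surj i (Equiv.swap 0 i * τ) (by simp [hτ.2])
      have h2 : insP i σ = τ := by
        rw [insP, hσ, ← mul_assoc, Equiv.swap_mul_self, one_mul]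
      refine ⟨σ, ?_, h2⟩
      simp only [Finset.mem_filter, Finset.mem_univ, true_and]
      rw [← insP_derangement i hi, h2]
      exact hτ.1
    · intro σ _
      rfl
  rw [h1]
  simp only [A, Finset.mul_sum]
  rw [Finset.sum_comm]
  refine Finset.sum_congr rfl fun σ _ => ?_
  rw [Finset.sum_eq_single (σ.symm 0)]
  · rw [wt_ins x y i hi σ (σ.symm 0) (by simp)]
    by_cases h : ∀ j, j ≠ 0 → σ j ≠ j
    · rw [if_pos h]
      congr 1
      rw [if_pos ⟨h, by simp⟩]
    · rw [if_neg h, if_neg (c := _ ∧ _) (fun h' => h h'.1), mul_zero]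
  · intro b _ hb
    rw [if_neg (c := _ ∧ _), mul_zero]
    rintro ⟨-, h⟩
    exact hb (by rw [← h]; simp)
  · simp

/-- For n ≥ 2 and 2 ≤ i ≤ n+1:
Q_{n+1,i} = x·Q_{n−1} + x·Σ_{j=2}^{i−1} Q_{n,j} + y·Σ_{j=i}^{n} Q_{n,j}. -/
theorem Qni_recurrence (x y : ℝ) (n i : ℕ) (hn : 2 ≤ n) (h2 : 2 ≤ i)
    (hi : i ≤ n + 1) :
    Qni (n + 1) i x y =
      x * Qn (n - 1) x y + x * ∑ j ∈ Finset.Icc 2 (i - 1), Qni n j x y +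
        y * ∑ j ∈ Finset.Icc i n, Qni n j x y := by
  obtain ⟨m, rfl⟩ : ∃ m, n = m + 2 := ⟨n - 2, by omega⟩
  obtain ⟨i, rfl⟩ : ∃ l, i = l + 1 := ⟨i - 1, by omega⟩
  have key := Qni_eq_A x y (m+1) ⟨i, by omega⟩ (by intro h; have := congrArg Fin.val h; simp at this; omega)
  simp only at key
  rw [show m + 2 + 1 = m + 1 + 2 from rfl, key, Fin.sum_univ_succ, A_zero]
  simp only [A_succ]
  rw [if_pos (by rw [Fin.lt_def]; simp; omega), show m + 2 - 1 = m + 1 by omega, add_assoc (x * Qn (m + 1) x y)]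
  congr 1
  have e1 : ∀ k : Fin (m+1), (if k.succ.castSucc < (⟨i, by omega⟩ : Fin (m+1+2)) then x else y) *
      Qni (m+1+1) (k+2) x y =
      (fun k : ℕ => (if k + 1 < i then x else y) * Qni (m+2) (k+2) x y) (k:ℕ) := by
    intro k
    simp only [Fin.lt_def, Fin.val_castSucc, Fin.val_succ]
  rw [Finset.sum_congr rfl fun k _ => e1 k, Fin.sum_univ_eq_sum_range (fun k : ℕ => (if k + 1 < i then x else y) * Qni (m+2) (k+2) x y)]
  have e2 : Finset.range (m+1) = Finset.range (i-1) ∪ Finset.Ico (i-1) (m+1) := by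
    ext a; simp; omega
  rw [e2, Finset.sum_union (by
    rw [Finset.disjoint_left]; intro a; simp; omega), Finset.mul_sum, Finset.mul_sum]
  congr 1
  · refine Finset.sum_bij (fun a _ => a + 2) ?_ ?_ ?_ ?_
    · intro a ha; simp at ha ⊢; omega
    · intro a _ b _ h; omega
    · intro b hb; simp at hb; exact ⟨b - 2, by simp; omega, by omega⟩
    · intro a ha; simp at ha; rw [if_pos (by omega)]
  · refine Finset.sum_bij (fun a _ => a + 2) ?_ ?_ ?_ ?_
    · intro a ha; simp at ha ⊢; omega
    · intro a _ b _ h; omega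
    · intro b hb; simp at hb; exact ⟨b - 2, by simp; omega, by omega⟩
    · intro a ha; simp at ha; rw [if_neg (by omega)]
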